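/- Let ω ∈ ℂ with Im ω > 0, let Λ = {n + m·ω : n, m ∈ ℤ} ⊂ ℂ, let a ∈ ℤ with |a| ≥ 2 and b ∈ ℂ, and let A : ℂ/Λ → ℂ/Λ be the map induced by z ↦ a·z + b. Let L ⊂ ℂ be a line on which π is injective and B ⊆ L a nondegenerate line segment. If π(L) is eventually periodic (there exist n ≥ 0 and p ≥ 1 with A^{n+p}(π(L)) = Aⁿ(π(L))), then there exists a nondegenerate line segment B₀ ⊆ B such that π(B₀) is a wandering continuum for A. -/

import Mathlib

open Complex

/-- The lattice Λ = {n + m·ω : n, m ∈ ℤ} as an additive subgroup of ℂ. -/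
noncomputable def Lambda (ω : ℂ) : AddSubgroup ℂ where
  carrier := {z : ℂ | ∃ n m : ℤ, z = (n : ℂ) + (m : ℂ) * ω}
  add_mem' := by
    rintro x y ⟨n1, m1, rfl⟩ ⟨n2, m2, rfl⟩
    exact ⟨n1 + n2, m1 + m2, by push_cast; ring⟩
  zero_mem' := ⟨0, 0, by simp⟩
  neg_mem' := by
    rintro x ⟨n, m, rfl⟩
    exact ⟨-n, -m, by push_cast; ring⟩

/-- The quotient map π : ℂ → ℂ/Λ. -/
noncomputable def pr (ω : ℂ) : ℂ → ℂ ⧸ Lambda ω := QuotientAddGroup.mk' (Lambda ω)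

/-- A line in ℂ. -/
def IsLine (L : Set ℂ) : Prop :=
  ∃ z₀ v : ℂ, v ≠ 0 ∧ L = {z | ∃ t : ℝ, z = z₀ + t * v}

/-- A nondegenerate line segment in ℂ. -/
def IsSegment (B : Set ℂ) : Prop :=
  ∃ z₀ v : ℂ, v ≠ 0 ∧ B = {z | ∃ t : ℝ, t ∈ Set.Icc (0 : ℝ) 1 ∧ z = z₀ + t * v}

/-- A continuum: a compact connected set with more than one point. -/
def IsContinuum {X : Type*} [TopologicalSpace X] (E : Set X) : Prop :=
  IsCompact E ∧ IsConnected E ∧ E.Nontrivial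

/-- E is wandering for A. -/
def Wandering {X : Type*} (A : X → X) (E : Set X) : Prop :=
  ∀ n m : ℕ, m < n → A^[n] '' E ∩ A^[m] '' E = ∅

/-- A continuum in the torus is simply-connected. -/
def IsSCContinuum (ω : ℂ) (E : Set (ℂ ⧸ Lambda ω)) : Prop :=
  ∃ U : Set (ℂ ⧸ Lambda ω), IsOpen U ∧ SimplyConnectedSpace U ∧ E ⊆ U ∧ IsConnected (U \ E)

/-- Iterates of an affine map act on differences by powers of the multiplier. -/
lemma iterate_affine_add {R : Type*} [CommSemiring R] (a b : R) (j : ℕ) (z w : R) :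
    (fun z => a * z + b)^[j] (z + w) = (fun z => a * z + b)^[j] z + a ^ j * w := by
  induction j with
  | zero => simp
  | succ j ih => rw [Function.iterate_succ_apply', Function.iterate_succ_apply', ih]; ring

lemma pr_eq_pr_iff {ω z w : ℂ} : pr ω z = pr ω w ↔ w - z ∈ Lambda ω := by
  rw [sub_eq_neg_add]
  exact QuotientAddGroup.eq

lemma continuous_pr (ω : ℂ) : Continuous (pr ω) :=
  continuous_quot_mk

lemma zsmul_mul_mem_Lambda {ω z : ℂ} (k : ℤ) (hz : z ∈ Lambda ω) : (k : ℂ) * z ∈ Lambda ω := by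
  simpa using (Lambda ω).zsmul_mem hz k

/-- If `w` is eventually periodic modulo `Λ` under `z ↦ a * z + b`, then two iterates of `w` that
differ modulo `Λ` by a real multiple of an irrational direction `u` agree modulo `Λ`. -/
lemma coeff_eq_zero_of_eventually_periodic {ω w u b : ℂ} {a : ℤ} {n p k m : ℕ} {c : ℝ}
    (ha : 2 ≤ |a|) (hp : 1 ≤ p) (hu : ∀ t : ℝ, (t : ℂ) * u ∈ Lambda ω → t = 0)
    (hw : (fun z => (a : ℂ) * z + b)^[n + p] w - (fun z => (a : ℂ) * z + b)^[n] w ∈ Lambda ω)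
    (hc : (fun z => (a : ℂ) * z + b)^[k] w - (fun z => (a : ℂ) * z + b)^[m] w + c * u
      ∈ Lambda ω) :
    c = 0 := by
  set f : ℂ → ℂ := fun z => (a : ℂ) * z + b with hf
  have key (j : ℕ) (x y : ℂ) : f^[j] x = f^[j] y + (a : ℂ) ^ j * (x - y) := by
    rw [← iterate_affine_add, add_sub_cancel]
  have e₁ := key n (f^[k] w) (f^[m] w)
  have e₂ := key (n + p) (f^[k] w) (f^[m] w)
  have e₃ := key k (f^[n + p] w) (f^[n] w)
  have e₄ := key m (f^[n + p] w) (f^[n] w)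
  simp only [← Function.iterate_add_apply] at e₁ e₂ e₃ e₄
  rw [add_comm k, add_comm k] at e₃
  rw [add_comm m, add_comm m] at e₄
  have h₁ := zsmul_mul_mem_Lambda (a ^ n * (a ^ p - 1)) hc
  have h₂ := zsmul_mul_mem_Lambda (a ^ k - a ^ m) hw
  have h₃ : ((a ^ n * (a ^ p - 1) * c : ℝ) : ℂ) * u ∈ Lambda ω := by
    convert (Lambda ω).sub_mem h₁ h₂ using 1
    push_cast
    linear_combination e₂ - e₁ - e₃ + e₄
  have ha₀ : (a : ℝ) ≠ 0 := by
    rintro h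
    simp [Int.cast_eq_zero.mp h] at ha
  have hap : (a : ℝ) ^ p - 1 ≠ 0 := by
    intro h
    have h' : |(a : ℝ)| ^ p = 1 := by rw [← abs_pow, sub_eq_zero.mp h, abs_one]
    have ha' : (1 : ℝ) < |(a : ℝ)| := by exact_mod_cast (by omega : 1 < |a|)
    exact (one_lt_pow₀ ha' (by omega)).ne' h'
  simpa [ha₀, hap] using hu _ h₃

/-- The unit interval contains a nondegenerate interval far from a given point `x`, relative to its
length. -/
lemma exists_Icc_abs_sub_lt_two_mul (x : ℝ) :
    ∃ α β : ℝ, 0 ≤ α ∧ α < β ∧ β ≤ 1 ∧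
      ∀ s ∈ Set.Icc α β, ∀ t ∈ Set.Icc α β, |t - x| < 2 * |s - x| := by
  rcases le_total x (1 / 2) with h | h
  · refine ⟨3 / 4, 7 / 8, by norm_num, by norm_num, by norm_num, ?_⟩
    rintro s ⟨hs, hs'⟩ t ⟨ht, ht'⟩
    rw [abs_of_pos (by linarith), abs_of_pos (by linarith)]
    linarith
  · refine ⟨1 / 8, 1 / 4, by norm_num, by norm_num, by norm_num, ?_⟩
    rintro s ⟨hs, hs'⟩ t ⟨ht, ht'⟩
    rw [abs_of_neg (by linarith), abs_of_neg (by linarith)]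
    linarith

lemma IsSegment.eq_image {B : Set ℂ} (hB : IsSegment B) :
    ∃ z v : ℂ, v ≠ 0 ∧ B = (fun t : ℝ => z + t * v) '' Set.Icc 0 1 := by
  obtain ⟨z, v, hv, rfl⟩ := hB
  exact ⟨z, v, hv, by ext x; simp [eq_comm, and_assoc]⟩

lemma IsSegment.isCompact {B : Set ℂ} (hB : IsSegment B) : IsCompact B := by
  obtain ⟨z, v, -, rfl⟩ := hB.eq_image
  exact isCompact_Icc.image (by fun_prop)

lemma IsSegment.isConnected {B : Set ℂ} (hB : IsSegment B) : IsConnected B := by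
  obtain ⟨z, v, -, rfl⟩ := hB.eq_image
  exact (isConnected_Icc zero_le_one).image _ (by fun_prop)

lemma IsSegment.nontrivial {B : Set ℂ} (hB : IsSegment B) : B.Nontrivial := by
  obtain ⟨z, v, hv, rfl⟩ := hB
  exact ⟨z, ⟨0, by simp⟩, z + v, ⟨1, by simp⟩, by simpa using hv⟩

/-- A line containing a segment is parametrized by the base point and direction of the segment. -/
lemma IsLine.eq_of_mem {L : Set ℂ} (hL : IsLine L) {z u : ℂ} (hu : u ≠ 0) (hz : z ∈ L)
    (hzu : z + u ∈ L) : L = {x | ∃ t : ℝ, x = z + t * u} := by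
  obtain ⟨z₀, v, hv, rfl⟩ := hL
  obtain ⟨r, rfl⟩ := hz
  obtain ⟨s, hs⟩ := hzu
  obtain rfl : u = ((s - r : ℝ) : ℂ) * v := by push_cast; linear_combination hs
  have hsr : ((s - r : ℝ) : ℂ) ≠ 0 := left_ne_zero_of_mul hu
  ext x
  constructor
  · rintro ⟨t, rfl⟩
    refine ⟨(t - r) / (s - r), ?_⟩
    push_cast at hsr ⊢
    field_simp
    ring
  · rintro ⟨t, rfl⟩
    exact ⟨r + t * (s - r), by push_cast; ring⟩

/-- Lemma 3.5(c): if π(L) is an eventually periodic line, then some subsegment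
B₀ ⊆ B projects to a wandering continuum. -/
theorem subsegment_wandering_of_eventually_periodic_line (ω : ℂ) (b : ℂ) (a : ℤ)
    (hω : 0 < ω.im) (ha : 2 ≤ |a|)
    (A : ℂ ⧸ Lambda ω → ℂ ⧸ Lambda ω)
    (hA : ∀ z : ℂ, A (pr ω z) = pr ω ((a : ℂ) * z + b))
    (L : Set ℂ) (hL : IsLine L)
    (B : Set ℂ) (hB : IsSegment B) (hBL : B ⊆ L)
    (hinj : Set.InjOn (pr ω) L)
    (hper : ∃ n p : ℕ, 1 ≤ p ∧ A^[n + p] '' (pr ω '' L) = A^[n] '' (pr ω '' L)) :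
    ∃ B₀ : Set ℂ, IsSegment B₀ ∧ B₀ ⊆ B ∧
      IsContinuum (pr ω '' B₀) ∧ Wandering A (pr ω '' B₀) := by
  obtain ⟨z, u, hu, rfl⟩ := hB
  obtain rfl := hL.eq_of_mem (z := z) hu (hBL ⟨0, by simp⟩) (hBL ⟨1, by simp⟩)
  have hirr (t : ℝ) (ht : (t : ℂ) * u ∈ Lambda ω) : t = 0 := by
    have h := hinj (x₁ := z + (0 : ℝ) * u) (x₂ := z + t * u) ⟨0, rfl⟩ ⟨t, rfl⟩
      (pr_eq_pr_iff.mpr (by simpa using ht))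
    simpa [hu] using h
  have hiter (j : ℕ) (x : ℂ) : A^[j] (pr ω x) = pr ω ((fun z => (a : ℂ) * z + b)^[j] x) :=
    (Function.Semiconj.iterate_right (f := pr ω) (fun x => (hA x).symm) j x).symm
  obtain ⟨n, p, hp, hper⟩ := hper
  have hap : (a : ℂ) ^ p - 1 ≠ 0 := by
    intro h
    have h' : |a| ^ p = 1 := by
      rw [← abs_pow, show a ^ p = 1 by exact_mod_cast sub_eq_zero.mp h, abs_one]
    exact (one_lt_pow₀ (by omega : 1 < |a|) (by omega)).ne' h'
  obtain ⟨x₀, hx₀⟩ : ∃ x₀ : ℝ, (fun z => (a : ℂ) * z + b)^[n + p] (z + x₀ * u) -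
      (fun z => (a : ℂ) * z + b)^[n] (z + x₀ * u) ∈ Lambda ω := by
    have hz : A^[n + p] (pr ω z) ∈ A^[n] '' (pr ω '' {x | ∃ t : ℝ, x = z + t * u}) :=
      hper ▸ ⟨_, ⟨z, ⟨0, by simp⟩, rfl⟩, rfl⟩
    obtain ⟨-, ⟨-, ⟨t, rfl⟩, rfl⟩, ht⟩ := hz
    rw [hiter, hiter, pr_eq_pr_iff, iterate_affine_add] at ht
    refine ⟨-t / (a ^ p - 1), ?_⟩
    rw [iterate_affine_add, iterate_affine_add]
    convert ht using 1
    push_cast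
    field_simp
    ring
  obtain ⟨α, β, hα, hαβ, hβ, hI⟩ := exists_Icc_abs_sub_lt_two_mul x₀
  have hpar {x : ℂ} (hx : x ∈ {x | ∃ t : ℝ, t ∈ Set.Icc (0 : ℝ) 1 ∧
      x = (z + α * u) + t * ((β - α : ℝ) * u)}) : ∃ s ∈ Set.Icc α β, x = z + s * u := by
    obtain ⟨t, ⟨ht₀, ht₁⟩, rfl⟩ := hx
    refine ⟨α + t * (β - α), ⟨?_, ?_⟩, by push_cast; ring⟩ <;> nlinarith
  have hseg : IsSegment {x | ∃ t : ℝ, t ∈ Set.Icc (0 : ℝ) 1 ∧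
      x = (z + α * u) + t * ((β - α : ℝ) * u)} :=
    ⟨_, _, mul_ne_zero (by exact_mod_cast (sub_pos.mpr hαβ).ne') hu, rfl⟩
  refine ⟨_, hseg, ?_, ⟨hseg.isCompact.image (continuous_pr ω),
    hseg.isConnected.image _ (continuous_pr ω).continuousOn,
    hseg.nontrivial.image_of_injOn (hinj.mono ?_)⟩, ?_⟩
  · intro x hx
    obtain ⟨s, hs, rfl⟩ := hpar hx
    exact ⟨s, ⟨hα.trans hs.1, hs.2.trans hβ⟩, rfl⟩
  · intro x hx
    obtain ⟨s, -, rfl⟩ := hpar hx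
    exact ⟨s, rfl⟩
  · intro k m hmk
    rw [← Set.disjoint_iff_inter_eq_empty, Set.disjoint_left]
    rintro - ⟨-, ⟨x, hx, rfl⟩, rfl⟩ ⟨-, ⟨y, hy, rfl⟩, hxy⟩
    obtain ⟨s, hs, rfl⟩ := hpar hx
    obtain ⟨t, ht, rfl⟩ := hpar hy
    have hsplit (r : ℝ) : z + r * u = (z + x₀ * u) + ((r - x₀ : ℝ) : ℂ) * u := by
      push_cast; ring
    rw [hiter, hiter, pr_eq_pr_iff, hsplit s, hsplit t, iterate_affine_add _ _ k (_ + _),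
      iterate_affine_add _ _ m (_ + _)] at hxy
    have hc : (a : ℝ) ^ k * (s - x₀) - a ^ m * (t - x₀) = 0 := by
      refine coeff_eq_zero_of_eventually_periodic (k := k) (m := m) ha hp hirr hx₀ ?_
      convert hxy using 1
      push_cast
      ring
    have ha' : (2 : ℝ) ≤ |(a : ℝ)| := by exact_mod_cast ha
    obtain ⟨d, rfl⟩ := Nat.exists_eq_add_of_lt hmk
    have ham : (a : ℝ) ^ m ≠ 0 := pow_ne_zero _ (abs_pos.mp (by linarith))
    have hst : t - x₀ = a ^ (d + 1) * (s - x₀) := by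
      apply mul_left_cancel₀ ham
      linear_combination -hc
    have hlt := hI s hs t ht
    rw [hst, abs_mul, abs_pow] at hlt
    have h₂ : 2 ≤ |(a : ℝ)| ^ (d + 1) :=
      ha'.trans (le_self_pow₀ (by linarith) (by omega))
    exact hlt.not_ge (mul_le_mul_of_nonneg_right h₂ (abs_nonneg _))
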